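/- Let T₁ and T₂ be arbitrary theories (their signatures need not be disjoint). Then T₁ and T₂ are definitionally mergeable if and only if they are model mergeable, i.e. T₁ ⋈ T₂ ⟺ Mod(T₁) ⋈ Mod(T₂). -/

import Mathlib

/-!
Formalization framework: first-order logic with equality over purely relational
signatures. A signature is a set `S : Set P` of predicate symbols, where each
symbol `p : P` has arity `ar p`. `Lang ar S` is the corresponding first-order
language, a theory is a set of sentences of that language, and `STheory`
bundles a theory with its signature.
-/

open FirstOrder Language

namespace DefEqPaper

variable {P : Type} {ar : P → ℕ}

/-- The first-order language (purely relational) of the signature `S`. -/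
def Lang (ar : P → ℕ) (S : Set P) : FirstOrder.Language where
  Functions _ := Empty
  Relations n := {p : P // p ∈ S ∧ ar p = n}

/-- A theory together with its signature. -/
structure STheory (P : Type) (ar : P → ℕ) where
  sig : Set P
  th : (Lang ar sig).Theory

/-- The inclusion of languages induced by an inclusion of signatures. -/
def langIncl {S S' : Set P} (h : S ⊆ S') : Lang ar S →ᴸ Lang ar S' where
  onFunction _ f := f.elim
  onRelation _ r := ⟨r.1, h r.2.1, r.2.2⟩

/-- Logical equivalence: two theories of the same language having the same class
of models. -/
def TheoryEquiv {L : FirstOrder.Language} (T T' : L.Theory) : Prop :=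
  ∀ (M : Type) [L.Structure M] [Nonempty M], (M ⊨ T ↔ M ⊨ T')

/-- The explicit definition `∀ x₁ … xₙ (p(x₁,…,xₙ) ↔ φ(x₁,…,xₙ))` of a relation
symbol `p ∈ S'` by a formula `φ` of the language of `S`, as a sentence of the
language of `S'`. -/
def explicitDef {S S' : Set P} (h : S ⊆ S') {p : P} (hp : p ∈ S')
    (φ : (Lang ar S).Formula (Fin (ar p))) : (Lang ar S').Sentence :=
  (BoundedFormula.iff
    (Relations.boundedFormula (⟨p, hp, rfl⟩ : (Lang ar S').Relations (ar p))
      (fun i => Term.var (Sum.inr i)))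
    (BoundedFormula.relabel Sum.inr ((langIncl h).onFormula φ))).alls

/-- `Δ` is a set consisting of one explicit definition, in terms of the language
of `S`, for each relation symbol of `S' \ S`. -/
def IsDefinitionSet {S S' : Set P} (h : S ⊆ S') (Δ : Set ((Lang ar S').Sentence)) : Prop :=
  ∃ d : (p : P) → p ∈ S' → p ∉ S → (Lang ar S).Formula (Fin (ar p)),
    Δ = {σ | ∃ (p : P) (hp : p ∈ S') (hn : p ∉ S), σ = explicitDef h hp (d p hp hn)}

/-- `T'` is a definitional extension of `T`: the signature of `T'` contains that of
`T` and `T'` is logically equivalent to `T ∪ Δ` for a set `Δ` of explicit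
definitions, in terms of the language of `T`, of the new relation symbols. -/
def DefExt (T T' : STheory P ar) : Prop :=
  ∃ h : T.sig ⊆ T'.sig, ∃ Δ : Set ((Lang ar T'.sig).Sentence),
    IsDefinitionSet h Δ ∧ TheoryEquiv ((langIncl h).onTheory T.th ∪ Δ) T'.th

/-- `T₁` and `T₂` are definitionally mergeable (Barrett–Halvorson): they have a
common definitional extension. -/
def Mergeable (T₁ T₂ : STheory P ar) : Prop :=
  ∃ T' : STheory P ar, DefExt T₁ T' ∧ DefExt T₂ T'

/-- Definitional equivalence (Andréka–Németi): there is a finite chain of theories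
connecting `T` and `T'` in which each consecutive pair is related by definitional
extension in one direction or the other. -/
def DefEquiv : STheory P ar → STheory P ar → Prop :=
  Relation.ReflTransGen (fun T T' => DefExt T T' ∨ DefExt T' T)

/-- Renaming of signatures along an arity-preserving map, as a map of languages. -/
def renameLHom {S S' : Set P} (ρ : P → P) (hmap : Set.MapsTo ρ S S')
    (har : ∀ p ∈ S, ar (ρ p) = ar p) : Lang ar S →ᴸ Lang ar S' where
  onFunction _ f := f.elim
  onRelation _ r := ⟨ρ r.1, hmap r.2.1, (har r.1 r.2.1).trans r.2.2⟩

/-- `T'` is a disjoint renaming of `T`: their signatures are disjoint and there is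
an arity-preserving bijection between the signatures under which the sentences of
`T'` are exactly the renamings of the sentences of `T`. -/
def IsDisjointRenaming (T T' : STheory P ar) : Prop :=
  Disjoint T.sig T'.sig ∧
    ∃ (ρ : P → P) (hbij : Set.BijOn ρ T.sig T'.sig)
      (har : ∀ p ∈ T.sig, ar (ρ p) = ar p),
      T'.th = (renameLHom ρ hbij.mapsTo har).onTheory T.th

/-- The variable of a term of a purely relational language. -/
def termVar {S : Set P} {β : Type} : (Lang ar S).Term β → β
  | .var v => v
  | .func f _ => f.elim

/-- The translation of formulas induced by a map `t` sending each `n`-ary relation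
symbol of the language of `S₁` to a formula of the language of `S₂` with (at most)
`n` free variables.  It maps `p(x₁,…,xₙ)` to `(t p)(x₁,…,xₙ)` and commutes with
equality and all connectives and quantifiers. -/
def trBF {S₁ S₂ : Set P} (t : ∀ n, (Lang ar S₁).Relations n → (Lang ar S₂).Formula (Fin n)) :
    ∀ {α : Type} {n : ℕ}, (Lang ar S₁).BoundedFormula α n → (Lang ar S₂).BoundedFormula α n
  | _, _, .falsum => .falsum
  | _, _, .equal t₁ t₂ => .equal (.var (termVar t₁)) (.var (termVar t₂))
  | _, _, .rel R ts => BoundedFormula.relabel (fun i => termVar (ts i)) (t _ R)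
  | _, _, .imp f g => (trBF t f).imp (trBF t g)
  | _, _, .all f => (trBF t f).all

/-- `φ` is a semantic consequence of the theory `T`. -/
def Conseq {L : FirstOrder.Language} (T : L.Theory) (φ : L.Sentence) : Prop :=
  ∀ (M : Type) [L.Structure M] [Nonempty M], M ⊨ T → M ⊨ φ

/-- The map `t` on relation symbols induces a translation of the theory `T₁` to the
theory `T₂`: it maps consequences of `T₁` to consequences of `T₂`. -/
def IsTranslation (T₁ T₂ : STheory P ar)
    (t : ∀ n, (Lang ar T₁.sig).Relations n → (Lang ar T₂.sig).Formula (Fin n)) : Prop :=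
  ∀ φ : (Lang ar T₁.sig).Sentence, Conseq T₁.th φ → Conseq T₂.th (trBF t φ)

/-- `T₁` and `T₂` are intertranslatable: there are translations `t₁₂` of `T₁` to `T₂`
and `t₂₁` of `T₂` to `T₁` such that
`T₁ ⊨ ∀ x̄ (φ(x̄) ↔ tr₂₁(tr₁₂(φ(x̄))))` for every formula `φ` of the language of `T₁`
and `T₂ ⊨ ∀ x̄ (ψ(x̄) ↔ tr₁₂(tr₂₁(ψ(x̄))))` for every formula `ψ` of the language of `T₂`. -/
def Intertranslatable (T₁ T₂ : STheory P ar) : Prop :=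
  ∃ (t₁₂ : ∀ n, (Lang ar T₁.sig).Relations n → (Lang ar T₂.sig).Formula (Fin n))
    (t₂₁ : ∀ n, (Lang ar T₂.sig).Relations n → (Lang ar T₁.sig).Formula (Fin n)),
    IsTranslation T₁ T₂ t₁₂ ∧ IsTranslation T₂ T₁ t₂₁ ∧
    (∀ (n : ℕ) (φ : (Lang ar T₁.sig).BoundedFormula Empty n),
      Conseq T₁.th ((φ.iff (trBF t₂₁ (trBF t₁₂ φ))).alls)) ∧
    (∀ (n : ℕ) (ψ : (Lang ar T₂.sig).BoundedFormula Empty n),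
      Conseq T₂.th ((ψ.iff (trBF t₁₂ (trBF t₂₁ ψ))).alls))

/-- The structure `tr*(𝔐)` induced on the underlying set of a structure `𝔐` for the
language of `S₂` by a translation-map `t`: each relation symbol `R` is interpreted by
the relation defined by the formula `t R` in `𝔐`. -/
def trStruc {S₁ S₂ : Set P} (t : ∀ n, (Lang ar S₁).Relations n → (Lang ar S₂).Formula (Fin n))
    (M : Type) (inst : (Lang ar S₂).Structure M) : (Lang ar S₁).Structure M where
  funMap f _ := f.elim
  RelMap {n} R x := letI := inst; (t n R).Realize x

end DefEqPaper

namespace DefEqPaper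

variable {P : Type} {ar : P → ℕ}

/-- Model mergeability: a bijection `β` between the class of models of `T₁` and the
class of models of `T₂`, defined along two sets of explicit definitions (given by the
defining formulas `d₁₂` and `d₂₁`), such that every model `𝔐` of `T₁` and its image
`β 𝔐` have the same underlying set, the relations of `β 𝔐` are the ones defined in
`𝔐` according to `d₁₂` (relation symbols shared by the two signatures keeping their
interpretation), and vice versa the relations of `𝔐` are the ones defined in `β 𝔐`
according to `d₂₁`. -/
def ModelMergeable (T₁ T₂ : STheory P ar) : Prop :=
  ∃ (d₁₂ : (p : P) → p ∈ T₂.sig → p ∉ T₁.sig → (Lang ar T₁.sig).Formula (Fin (ar p)))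
    (d₂₁ : (p : P) → p ∈ T₁.sig → p ∉ T₂.sig → (Lang ar T₂.sig).Formula (Fin (ar p)))
    (β : Theory.ModelType.{0,0,0} T₁.th ≃ Theory.ModelType.{0,0,0} T₂.th),
    ∀ M : Theory.ModelType.{0,0,0} T₁.th, ∃ hc : ((β M : Type) = (M : Type)),
      (∀ (p : P) (hp2 : p ∈ T₂.sig) (hp1 : p ∈ T₁.sig) (x : Fin (ar p) → (M : Type)),
        Structure.RelMap (L := Lang ar T₂.sig) (M := (β M : Type))
            (⟨p, hp2, rfl⟩ : (Lang ar T₂.sig).Relations (ar p)) (fun i => cast hc.symm (x i)) ↔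
          Structure.RelMap (L := Lang ar T₁.sig) (M := (M : Type))
            (⟨p, hp1, rfl⟩ : (Lang ar T₁.sig).Relations (ar p)) x) ∧
      (∀ (p : P) (hp2 : p ∈ T₂.sig) (hn1 : p ∉ T₁.sig) (x : Fin (ar p) → (M : Type)),
        Structure.RelMap (L := Lang ar T₂.sig) (M := (β M : Type))
            (⟨p, hp2, rfl⟩ : (Lang ar T₂.sig).Relations (ar p)) (fun i => cast hc.symm (x i)) ↔
          (d₁₂ p hp2 hn1).Realize x) ∧
      (∀ (p : P) (hp1 : p ∈ T₁.sig) (hn2 : p ∉ T₂.sig) (x : Fin (ar p) → (M : Type)),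
        Structure.RelMap (L := Lang ar T₁.sig) (M := (M : Type))
            (⟨p, hp1, rfl⟩ : (Lang ar T₁.sig).Relations (ar p)) x ↔
          (d₂₁ p hp1 hn2).Realize (fun i => cast hc.symm (x i)))

end DefEqPaper

namespace DefEqPaper

/-- The interpretation of the symbol `p` in the structure `I`. -/
def interp {P : Type} {ar : P → ℕ} {S : Set P} {M : Type} (I : (Lang ar S).Structure M)
    (p : P) (hp : p ∈ S) (x : Fin (ar p) → M) : Prop :=
  I.RelMap (⟨p, hp, rfl⟩ : (Lang ar S).Relations (ar p)) x

/-- The formulas `d` define, in the structure `I`, the interpretation in `J` of the relation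
symbols of the signature of `J` that do not belong to the signature of `I`. -/
def DefinedBy {P : Type} {ar : P → ℕ} {S S' : Set P} {M : Type}
    (d : (p : P) → p ∈ S' → p ∉ S → (Lang ar S).Formula (Fin (ar p)))
    (I : (Lang ar S).Structure M) (J : (Lang ar S').Structure M) : Prop :=
  ∀ (p : P) (hp : p ∈ S') (hn : p ∉ S) (x : Fin (ar p) → M),
    interp J p hp x ↔ (d p hp hn).Realize x

/-- Two structures on the same set agree on the symbols common to their signatures. -/
def Agree {P : Type} {ar : P → ℕ} {S S' : Set P} {M : Type}
    (I : (Lang ar S).Structure M) (J : (Lang ar S').Structure M) : Prop :=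
  ∀ (p : P) (hp : p ∈ S) (hp' : p ∈ S') (x : Fin (ar p) → M),
    interp J p hp' x ↔ interp I p hp x

section

variable {P : Type} {ar : P → ℕ} {S S' S₁ S₂ : Set P} {M : Type}

theorem Agree.symm {I : (Lang ar S).Structure M} {J : (Lang ar S').Structure M}
    (h : Agree I J) : Agree J I :=
  fun p hp hp' x => (h p hp' hp x).symm

theorem structure_ext {I J : (Lang ar S).Structure M}
    (h : ∀ (p : P) (hp : p ∈ S) (x : Fin (ar p) → M), interp I p hp x ↔ interp J p hp x) :
    I = J := by
  obtain ⟨fI, rI⟩ := I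
  obtain ⟨fJ, rJ⟩ := J
  congr 1
  · funext n f
    exact f.elim
  · funext n ⟨p, hp, hn⟩ x
    subst hn
    exact propext (h p hp x)

/-- A structure is determined by a structure that it agrees with and that defines its remaining
relations. -/
theorem eq_of_definedBy {d : (p : P) → p ∈ S' → p ∉ S → (Lang ar S).Formula (Fin (ar p))}
    {I : (Lang ar S).Structure M} {J J' : (Lang ar S').Structure M}
    (ha : Agree I J) (hd : DefinedBy d I J) (ha' : Agree I J') (hd' : DefinedBy d I J') :
    J = J' := by
  refine structure_ext fun p hp x => ?_
  by_cases hn : p ∈ S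
  · exact (ha p hn hp x).trans (ha' p hn hp x).symm
  · exact (hd p hp hn x).trans (hd' p hp hn x).symm

/-- The reduct of a structure to a smaller signature. -/
@[reducible] def sigReduct (h : S ⊆ S') (J : (Lang ar S').Structure M) :
    (Lang ar S).Structure M :=
  letI := J
  (langIncl h).reduct M

theorem interp_sigReduct (h : S ⊆ S') (J : (Lang ar S').Structure M) (p : P) (hp : p ∈ S)
    (x : Fin (ar p) → M) : interp (sigReduct h J) p hp x ↔ interp J p (h hp) x :=
  Iff.rfl

theorem realize_explicitDef (h : S ⊆ S') (J : (Lang ar S').Structure M) {p : P} (hp : p ∈ S')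
    (φ : (Lang ar S).Formula (Fin (ar p))) :
    M ⊨ explicitDef h hp φ ↔
      ∀ x : Fin (ar p) → M,
        interp J p hp x ↔ letI := sigReduct h J; φ.Realize x := by
  let _ := sigReduct h J
  have : (langIncl h : Lang ar S →ᴸ Lang ar S').IsExpansionOn M :=
    ⟨fun f _ => f.elim, fun _ _ => rfl⟩
  refine BoundedFormula.realize_alls.trans (forall_congr' fun x => ?_)
  rw [BoundedFormula.realize_iff, Formula.realize_relabel_sumInr, LHom.realize_onFormula]
  exact Iff.rfl

theorem model_union_definitions_iff (h : S ⊆ S') (J : (Lang ar S').Structure M)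
    (T : (Lang ar S).Theory)
    (d : (p : P) → p ∈ S' → p ∉ S → (Lang ar S).Formula (Fin (ar p))) :
    (M ⊨ ((langIncl h).onTheory T ∪
        {σ | ∃ (p : P) (hp : p ∈ S') (hn : p ∉ S), σ = explicitDef h hp (d p hp hn)} :
          (Lang ar S').Theory)) ↔
      @Theory.Model _ M (sigReduct h J) T ∧ DefinedBy d (sigReduct h J) J := by
  let _ := sigReduct h J
  have : (langIncl h : Lang ar S →ᴸ Lang ar S').IsExpansionOn M :=
    ⟨fun f _ => f.elim, fun _ _ => rfl⟩
  rw [Theory.model_union_iff, LHom.onTheory_model]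
  refine and_congr_right fun _ => ?_
  rw [Theory.model_iff]
  constructor
  · intro H p hp hn
    exact (realize_explicitDef h J hp _).1 (H _ ⟨p, hp, hn, rfl⟩)
  · rintro H _ ⟨p, hp, hn, rfl⟩
    exact (realize_explicitDef h J hp _).2 (H p hp hn)

open Classical in
/-- The expansion of a structure to a larger signature by explicit definitions. -/
@[reducible] noncomputable def expansion
    (d : (p : P) → p ∈ S' → p ∉ S → (Lang ar S).Formula (Fin (ar p)))
    (I : (Lang ar S).Structure M) : (Lang ar S').Structure M where
  funMap f _ := f.elim
  RelMap R x :=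
    if hp : R.1 ∈ S then interp I R.1 hp (x ∘ Fin.cast R.2.2)
    else (d R.1 R.2.1 hp).Realize (x ∘ Fin.cast R.2.2)

theorem sigReduct_expansion (h : S ⊆ S')
    (d : (p : P) → p ∈ S' → p ∉ S → (Lang ar S).Formula (Fin (ar p)))
    (I : (Lang ar S).Structure M) : sigReduct h (expansion d I) = I :=
  structure_ext fun p hp x =>
    iff_of_eq (dif_pos hp : interp (expansion d I) p (h hp) x = interp I p hp x)

theorem definedBy_expansion
    (d : (p : P) → p ∈ S' → p ∉ S → (Lang ar S).Formula (Fin (ar p)))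
    (I : (Lang ar S).Structure M) : DefinedBy d I (expansion d I) :=
  fun _ _ hn _ => iff_of_eq (dif_neg hn)

/-- Every model of `T₁` yields a model of `T₂` on the same set such that the two models agree on
the common symbols and define each other along `d₁₂` and `d₂₁`. -/
def HasCounterparts (T₁ T₂ : STheory P ar)
    (d₁₂ : (p : P) → p ∈ T₂.sig → p ∉ T₁.sig → (Lang ar T₁.sig).Formula (Fin (ar p)))
    (d₂₁ : (p : P) → p ∈ T₁.sig → p ∉ T₂.sig → (Lang ar T₂.sig).Formula (Fin (ar p))) : Prop :=
  ∀ (M : Type) (I : (Lang ar T₁.sig).Structure M) (_ : Nonempty M), M ⊨ T₁.th →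
    ∃ J : (Lang ar T₂.sig).Structure M,
      M ⊨ T₂.th ∧ Agree I J ∧ DefinedBy d₁₂ I J ∧ DefinedBy d₂₁ J I

theorem modelType_ext {L : FirstOrder.Language.{0, 0}} {T : L.Theory}
    {A B : Theory.ModelType.{0, 0, 0} T} (hc : (A : Type) = (B : Type))
    (hs : HEq A.struc B.struc) : A = B := by
  obtain ⟨A⟩ := A
  obtain ⟨B⟩ := B
  cases hc
  cases hs
  rfl

theorem modelMergeable_of_hasCounterparts {T₁ T₂ : STheory P ar}
    {d₁₂ : (p : P) → p ∈ T₂.sig → p ∉ T₁.sig → (Lang ar T₁.sig).Formula (Fin (ar p))}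
    {d₂₁ : (p : P) → p ∈ T₁.sig → p ∉ T₂.sig → (Lang ar T₂.sig).Formula (Fin (ar p))}
    (h₁₂ : HasCounterparts T₁ T₂ d₁₂ d₂₁) (h₂₁ : HasCounterparts T₂ T₁ d₂₁ d₁₂) :
    ModelMergeable T₁ T₂ := by
  choose J hJ haJ hdJ hdJ' using h₁₂
  choose I hI haI hdI hdI' using h₂₁
  refine ⟨d₁₂, d₂₁,
    { toFun := fun A => @Theory.ModelType.mk _ _ A (J A A.struc A.nonempty' A.is_model)
        (hJ A A.struc A.nonempty' A.is_model) A.nonempty'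
      invFun := fun B => @Theory.ModelType.mk _ _ B (I B B.struc B.nonempty' B.is_model)
        (hI B B.struc B.nonempty' B.is_model) B.nonempty'
      left_inv := fun A => modelType_ext rfl (heq_of_eq ?_)
      right_inv := fun B => modelType_ext rfl (heq_of_eq ?_) }, fun A => ⟨rfl, ?_, ?_, ?_⟩⟩
  · exact eq_of_definedBy (haI _ _ _ _) (hdI _ _ _ _) (haJ _ _ _ _).symm (hdJ' _ _ _ _)
  · exact eq_of_definedBy (haJ _ _ _ _) (hdJ _ _ _ _) (haI _ _ _ _).symm (hdI' _ _ _ _)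
  · exact fun p hp₂ hp₁ x => haJ A A.struc A.nonempty' A.is_model p hp₁ hp₂ x
  · exact fun p hp₂ hn₁ x => hdJ A A.struc A.nonempty' A.is_model p hp₂ hn₁ x
  · exact fun p hp₁ hn₂ x => hdJ' A A.struc A.nonempty' A.is_model p hp₁ hn₂ x

theorem exists_counterparts_of_cast {T₁ : (Lang ar S₁).Theory} {T₂ : (Lang ar S₂).Theory}
    {d₁₂ : (p : P) → p ∈ S₂ → p ∉ S₁ → (Lang ar S₁).Formula (Fin (ar p))}
    {d₂₁ : (p : P) → p ∈ S₁ → p ∉ S₂ → (Lang ar S₂).Formula (Fin (ar p))}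
    {M N : Type} [I : (Lang ar S₁).Structure M] [J : (Lang ar S₂).Structure N]
    (hI : M ⊨ T₁) (hJ : N ⊨ T₂) (hc : N = M)
    (ha : ∀ (p : P) (hp₂ : p ∈ S₂) (hp₁ : p ∈ S₁) (x : Fin (ar p) → M),
      interp J p hp₂ (fun i => cast hc.symm (x i)) ↔ interp I p hp₁ x)
    (hd : ∀ (p : P) (hp₂ : p ∈ S₂) (hn₁ : p ∉ S₁) (x : Fin (ar p) → M),
      interp J p hp₂ (fun i => cast hc.symm (x i)) ↔ (d₁₂ p hp₂ hn₁).Realize x)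
    (hd' : ∀ (p : P) (hp₁ : p ∈ S₁) (hn₂ : p ∉ S₂) (x : Fin (ar p) → M),
      interp I p hp₁ x ↔ (d₂₁ p hp₁ hn₂).Realize (fun i => cast hc.symm (x i))) :
    (∃ J' : (Lang ar S₂).Structure M,
      M ⊨ T₂ ∧ Agree I J' ∧ DefinedBy d₁₂ I J' ∧ DefinedBy d₂₁ J' I) ∧
    (∃ I' : (Lang ar S₁).Structure N,
      N ⊨ T₁ ∧ Agree J I' ∧ DefinedBy d₂₁ J I' ∧ DefinedBy d₁₂ I' J) := by
  cases hc
  have hIJ : Agree I J := fun p hp₁ hp₂ => ha p hp₂ hp₁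
  exact ⟨⟨J, hJ, hIJ, hd, hd'⟩, ⟨I, hI, hIJ.symm, hd', hd⟩⟩

theorem ModelMergeable.exists_hasCounterparts {T₁ T₂ : STheory P ar}
    (h : ModelMergeable T₁ T₂) :
    ∃ d₁₂ d₂₁, HasCounterparts T₁ T₂ d₁₂ d₂₁ ∧ HasCounterparts T₂ T₁ d₂₁ d₁₂ := by
  obtain ⟨d₁₂, d₂₁, β, hβ⟩ := h
  choose hc ha hd hd' using hβ
  have key (A : Theory.ModelType.{0, 0, 0} T₁.th) :=
    exists_counterparts_of_cast A.is_model (β A).is_model (hc A) (ha A) (hd A)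
      (hd' A)
  refine ⟨d₁₂, d₂₁, fun M I hM hI => (key (Theory.ModelType.mk M)).1, fun M J hM hJ => ?_⟩
  have H := (key (β.symm (Theory.ModelType.mk M))).2
  rw [β.apply_symm_apply] at H
  exact H

theorem hasCounterparts_of_theoryEquiv {T₁ T₂ T' : STheory P ar}
    (h₁ : T₁.sig ⊆ T'.sig) (h₂ : T₂.sig ⊆ T'.sig)
    {d₁ : (p : P) → p ∈ T'.sig → p ∉ T₁.sig → (Lang ar T₁.sig).Formula (Fin (ar p))}
    {d₂ : (p : P) → p ∈ T'.sig → p ∉ T₂.sig → (Lang ar T₂.sig).Formula (Fin (ar p))}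
    (e₁ : TheoryEquiv ((langIncl h₁).onTheory T₁.th ∪
      {σ | ∃ (p : P) (hp : p ∈ T'.sig) (hn : p ∉ T₁.sig), σ = explicitDef h₁ hp (d₁ p hp hn)})
      T'.th)
    (e₂ : TheoryEquiv ((langIncl h₂).onTheory T₂.th ∪
      {σ | ∃ (p : P) (hp : p ∈ T'.sig) (hn : p ∉ T₂.sig), σ = explicitDef h₂ hp (d₂ p hp hn)})
      T'.th) :
    HasCounterparts T₁ T₂ (fun p hp hn => d₁ p (h₂ hp) hn)
      (fun p hp hn => d₂ p (h₁ hp) hn) := by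
  intro M I _ hI
  let K : (Lang ar T'.sig).Structure M := expansion d₁ I
  have hK : sigReduct h₁ K = I := sigReduct_expansion h₁ d₁ I
  have hd₁ : DefinedBy d₁ I K := definedBy_expansion d₁ I
  have hT₁ := (model_union_definitions_iff h₁ K T₁.th d₁).2 (by rw [hK]; exact ⟨hI, hd₁⟩)
  obtain ⟨hT₂, hd₂⟩ := (model_union_definitions_iff h₂ K T₂.th d₂).1
    ((e₂ M).2 ((e₁ M).1 hT₁))
  refine ⟨sigReduct h₂ K, hT₂, ?_, fun p hp hn x => hd₁ p (h₂ hp) hn x, ?_⟩ <;>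
    rw [← hK]
  · exact fun _ _ _ _ => Iff.rfl
  · exact fun p hp hn x => hd₂ p (h₁ hp) hn x

/-- Definitions of the symbols of `S₂ \ S₁`, as definitions of the symbols of `S \ S₁` where
`S ⊆ S₁ ∪ S₂`. -/
def extendDefs (hS : S ⊆ S₁ ∪ S₂)
    (d : (p : P) → p ∈ S₂ → p ∉ S₁ → (Lang ar S₁).Formula (Fin (ar p))) :
    (p : P) → p ∈ S → p ∉ S₁ → (Lang ar S₁).Formula (Fin (ar p)) :=
  fun p hp hn => d p ((hS hp).resolve_left hn) hn

theorem HasCounterparts.sigReduct_model {T₁ T₂ : STheory P ar}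
    {d₁₂ : (p : P) → p ∈ T₂.sig → p ∉ T₁.sig → (Lang ar T₁.sig).Formula (Fin (ar p))}
    {d₂₁ : (p : P) → p ∈ T₁.sig → p ∉ T₂.sig → (Lang ar T₂.sig).Formula (Fin (ar p))}
    (H : HasCounterparts T₁ T₂ d₁₂ d₂₁) (h₁ : T₁.sig ⊆ S) (h₂ : T₂.sig ⊆ S)
    (hS₁ : S ⊆ T₁.sig ∪ T₂.sig) (hS₂ : S ⊆ T₂.sig ∪ T₁.sig) [hM : Nonempty M]
    {K : (Lang ar S).Structure M}
    (hK : @Theory.Model _ M (sigReduct h₁ K) T₁.th ∧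
      DefinedBy (extendDefs hS₁ d₁₂) (sigReduct h₁ K) K) :
    @Theory.Model _ M (sigReduct h₂ K) T₂.th ∧
      DefinedBy (extendDefs hS₂ d₂₁) (sigReduct h₂ K) K := by
  obtain ⟨hT, hd⟩ := hK
  obtain ⟨J, hJ, ha, hdJ, hdI⟩ := H M (sigReduct h₁ K) hM hT
  have e : J = sigReduct h₂ K :=
    eq_of_definedBy ha hdJ (fun _ _ _ _ => Iff.rfl) (fun p hp hn x => hd p (h₂ hp) hn x)
  subst e
  exact ⟨hJ, fun p hp hn x => hdI p ((hS₂ hp).resolve_left hn) hn x⟩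

theorem mergeable_of_hasCounterparts {T₁ T₂ : STheory P ar}
    {d₁₂ : (p : P) → p ∈ T₂.sig → p ∉ T₁.sig → (Lang ar T₁.sig).Formula (Fin (ar p))}
    {d₂₁ : (p : P) → p ∈ T₁.sig → p ∉ T₂.sig → (Lang ar T₂.sig).Formula (Fin (ar p))}
    (h₁₂ : HasCounterparts T₁ T₂ d₁₂ d₂₁) (h₂₁ : HasCounterparts T₂ T₁ d₂₁ d₁₂) :
    Mergeable T₁ T₂ := by
  have hS₁ : T₁.sig ∪ T₂.sig ⊆ T₁.sig ∪ T₂.sig := subset_rfl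
  have hS₂ : T₁.sig ∪ T₂.sig ⊆ T₂.sig ∪ T₁.sig := (Set.union_comm _ _).subset
  have h₁ : T₁.sig ⊆ T₁.sig ∪ T₂.sig := Set.subset_union_left
  have h₂ : T₂.sig ⊆ T₁.sig ∪ T₂.sig := Set.subset_union_right
  refine ⟨⟨T₁.sig ∪ T₂.sig, (langIncl h₁).onTheory T₁.th ∪
      {σ | ∃ p hp hn, σ = explicitDef h₁ hp (extendDefs hS₁ d₁₂ p hp hn)}⟩,
    ⟨h₁, _, ⟨extendDefs hS₁ d₁₂, rfl⟩, fun _ _ _ => Iff.rfl⟩,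
    ⟨h₂, _, ⟨extendDefs hS₂ d₂₁, rfl⟩, fun M K _ => ?_⟩⟩
  rw [model_union_definitions_iff, model_union_definitions_iff]
  exact ⟨h₂₁.sigReduct_model h₂ h₁ hS₂ hS₁, h₁₂.sigReduct_model h₁ h₂ hS₁ hS₂⟩

end

/-- Theorem 7: two arbitrary theories are definitionally mergeable iff they are
model mergeable. -/
theorem mergeable_iff_modelMergeable {P : Type} {ar : P → ℕ} (T₁ T₂ : STheory P ar) :
    Mergeable T₁ T₂ ↔ ModelMergeable T₁ T₂ := by
  constructor
  · rintro ⟨T', ⟨h₁, _, ⟨d₁, rfl⟩, e₁⟩, h₂, _, ⟨d₂, rfl⟩, e₂⟩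
    exact modelMergeable_of_hasCounterparts (hasCounterparts_of_theoryEquiv h₁ h₂ e₁ e₂)
      (hasCounterparts_of_theoryEquiv h₂ h₁ e₂ e₁)
  · intro h
    obtain ⟨d₁₂, d₂₁, h₁₂, h₂₁⟩ := h.exists_hasCounterparts
    exact mergeable_of_hasCounterparts h₁₂ h₂₁

end DefEqPaper
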